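/- Let μ, ν ∈ 𝒫_{2,ac}(ℝ^d) and suppose μ_k, ν_k ∈ 𝒫₂(ℝ^d) satisfy W₂(μ_k, μ) → 0 and W₂(ν_k, ν) → 0. For each k let γ_k be an optimal coupling of (μ_k, ν_k), let γ be the (unique) optimal coupling of (μ, ν), and define the geodesic interpolations η_t^k = ((x,y) ↦ (1−t)x + ty)_# γ_k and η_t = ((x,y) ↦ (1−t)x + ty)_# γ. Then for every t ∈ [0,1], W₂(η_t^k, η_t) → 0 as k → ∞. -/

import Mathlib

open MeasureTheory Filter Topology ProbabilityTheory
open scoped ENNReal NNReal RealInnerProductSpace BigOperators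

noncomputable section

/-- Euclidean space `ℝ^d`. -/
abbrev Ed (d : ℕ) : Type := EuclideanSpace ℝ (Fin d)

/-- `γ` is a coupling of `μ` and `ν`: a joint probability measure on `ℝ^d × ℝ^d`
with marginals `μ` and `ν`. -/
def IsCoupling {d : ℕ} (γ : Measure (Ed d × Ed d)) (μ ν : Measure (Ed d)) : Prop :=
  IsProbabilityMeasure γ ∧ γ.map Prod.fst = μ ∧ γ.map Prod.snd = ν

/-- The set of quadratic transport costs of couplings between `μ` and `ν`. -/
def transportCosts {d : ℕ} (μ ν : Measure (Ed d)) : Set ℝ :=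
  {c : ℝ | ∃ γ : Measure (Ed d × Ed d), IsCoupling γ μ ν ∧ c = ∫ p, ‖p.1 - p.2‖ ^ 2 ∂γ}

/-- The 2-Wasserstein distance `W₂(μ,ν)`. -/
def W2 {d : ℕ} (μ ν : Measure (Ed d)) : ℝ :=
  Real.sqrt (sInf (transportCosts μ ν))

/-- `μ ∈ 𝒫₂(ℝ^d)`: a probability measure with finite second moment. -/
def MemP2 {d : ℕ} (μ : Measure (Ed d)) : Prop :=
  IsProbabilityMeasure μ ∧ Integrable (fun x => ‖x‖ ^ 2) μ

/-- The Borel σ-algebra of the `W₂`-topology on measures: the σ-algebra generated by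
`W₂`-balls. -/
def W2MS (d : ℕ) : MeasurableSpace (Measure (Ed d)) :=
  MeasurableSpace.generateFrom {s : Set (Measure (Ed d)) | ∃ μ r, s = {ν | W2 μ ν < r}}

/-- `ξ ∈ L²_W(ℝ^d)`: a random probability measure with realisations in `𝒫₂(ℝ^d)`,
measurable w.r.t. the Borel σ-algebra of the `W₂` topology, with finite second energy. -/
structure MemL2W {d : ℕ} {Ω : Type*} [MeasurableSpace Ω] (P : Measure Ω)
    (ξ : Ω → Measure (Ed d)) : Prop where
  prob : ∀ ω, IsProbabilityMeasure (ξ ω)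
  mom : ∀ ω, Integrable (fun x => ‖x‖ ^ 2) (ξ ω)
  meas : @Measurable Ω (Measure (Ed d)) _ (W2MS d) ξ
  energy : Integrable (fun ω => ∫ x, ‖x‖ ^ 2 ∂(ξ ω)) P

/-- The `L²` over Wasserstein distance `d(ξ,η) = E_ω[W₂²(ξ(ω),η(ω))]^{1/2}`. -/
def dL2 {d : ℕ} {Ω : Type*} [MeasurableSpace Ω] (P : Measure Ω)
    (ξ η : Ω → Measure (Ed d)) : ℝ :=
  Real.sqrt (∫ ω, (W2 (ξ ω) (η ω)) ^ 2 ∂P)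

/-- The geodesic (coupling) interpolation `η_t = ((x,y) ↦ (1−t)x + ty)_# γ`. -/
def couplingInterp {d : ℕ} (γ : Measure (Ed d × Ed d)) (t : ℝ) : Measure (Ed d) :=
  γ.map (fun p => (1 - t) • p.1 + t • p.2)

/-- `γ` is an optimal coupling of `(μ,ν)` for the quadratic cost. -/
def IsOptimalCoupling {d : ℕ} (γ : Measure (Ed d × Ed d)) (μ ν : Measure (Ed d)) : Prop :=
  IsCoupling γ μ ν ∧ ∫ p, ‖p.1 - p.2‖ ^ 2 ∂γ = (W2 μ ν) ^ 2


section KeyLemma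
variable {d : ℕ}

/-- Lipschitz images of null sets are null. -/
theorem lip_null {f : Ed d → Ed d} {s : Set (Ed d)} {K : ℝ≥0} (hf : LipschitzOnWith K f s)
    (hs : volume s = 0) : volume (f '' s) = 0 := by
  have h1 : (Measure.hausdorffMeasure (d : ℝ) : Measure (Ed d)).IsAddHaarMeasure := by
    simpa using MeasureTheory.isAddHaarMeasure_hausdorffMeasure (E := EuclideanSpace ℝ (Fin d))
  have hac1 : (Measure.hausdorffMeasure (d : ℝ) : Measure (Ed d)) ≪ volume :=
    Measure.absolutelyContinuous_isAddHaarMeasure _ _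
  have hac2 : (volume : Measure (Ed d)) ≪ Measure.hausdorffMeasure (d : ℝ) :=
    Measure.absolutelyContinuous_isAddHaarMeasure _ _
  apply hac2
  have := hf.hausdorffMeasure_image_le (d := (d : ℝ)) (by positivity)
  rw [hac1 hs, mul_zero] at this
  exact le_antisymm this zero_le

def MonoSet (S : Set (Ed d × Ed d)) : Prop :=
  ∀ p ∈ S, ∀ q ∈ S, 0 ≤ ⟪p.1 - q.1, p.2 - q.2⟫

def MonoRel (S : Set (Ed d × Ed d)) (x y : Ed d) : Prop :=
  ∀ q ∈ S, 0 ≤ ⟪q.1 - x, q.2 - y⟫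

theorem det_zero_of_density {R : Ed d → Ed d} {U : Set (Ed d)} {u e : Ed d}
    {A : Ed d →L[ℝ] Ed d} (hA : HasFDerivWithinAt R A U u)
    (hdens : Tendsto (fun r => volume (U ∩ Metric.closedBall u r) / volume (Metric.closedBall u r))
      (𝓝[>] 0) (𝓝 1)) (he : e ≠ 0)
    (hle : ∀ v ∈ U, ⟪R v - R u, e⟫ ≤ ‖v - u‖ ^ 2) : A.det = 0 := by
  by_contra hdet
  obtain ⟨w, hw⟩ : ∃ w, A w = e := by
    have hu : IsUnit (LinearMap.det (A : Ed d →ₗ[ℝ] Ed d)) := isUnit_iff_ne_zero.2 hdet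
    have := (LinearMap.equivOfIsUnitDet hu).surjective e
    obtain ⟨w, hw⟩ := this
    exact ⟨w, by simpa using hw⟩
  set c : ℝ := ‖e‖ ^ 2 with hc
  have hcpos : 0 < c := by positivity
  -- the set of directions
  set t : Set (Ed d) := {w' | c / 2 < ⟪A w', e⟫} ∩ Metric.ball w 1 with ht
  have htopen : IsOpen t := by
    refine IsOpen.inter (isOpen_lt continuous_const (by fun_prop)) Metric.isOpen_ball
  have hwt : w ∈ t := by
    refine ⟨?_, by simp⟩
    simp only [Set.mem_ofPred_eq, hw, real_inner_self_eq_norm_sq]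
    linarith
  have htm : volume t ≠ 0 := (htopen.measure_pos _ ⟨w, hwt⟩).ne'
  have hev := MeasureTheory.Measure.eventually_nonempty_inter_smul_of_density_one volume U u hdens t
    htopen.measurableSet htm
  set M : ℝ := ‖w‖ + 1 with hM
  have hMpos : 0 < M := by positivity
  set ε : ℝ := c / (8 * M * (‖e‖ + 1)) with hε
  have hεpos : 0 < ε := by positivity
  have hlit := hA.isLittleO.def hεpos
  rw [eventually_nhdsWithin_iff, Metric.eventually_nhds_iff] at hlit
  obtain ⟨ρ, hρ, hlit⟩ := hlit
  have hr1 : ∀ᶠ r in 𝓝[>] (0 : ℝ), r < ρ / M ∧ r < c / (8 * M ^ 2) :=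
    Filter.inter_mem (nhdsWithin_le_nhds (Iio_mem_nhds (by positivity)))
      (nhdsWithin_le_nhds (Iio_mem_nhds (by positivity)))
  obtain ⟨r, ⟨v, hvU, hv⟩, ⟨hr1, hr2⟩, hr0⟩ := (hev.and (hr1.and self_mem_nhdsWithin)).exists
  have hr0 : 0 < r := hr0
  obtain ⟨w', hw't, hveq⟩ : ∃ w' ∈ t, v = u + r • w' := by
    rw [Set.singleton_add] at hv
    obtain ⟨_, ⟨w', hw', rfl⟩, rfl⟩ := hv
    exact ⟨w', hw', rfl⟩
  have hvu : v - u = r • w' := by rw [hveq]; abel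
  have hnw : ‖w'‖ ≤ M := by
    have := hw't.2
    rw [Metric.mem_ball, dist_eq_norm] at this
    have h2 := norm_le_norm_add_norm_sub' w' w
    linarith
  have hn : ‖v - u‖ ≤ r * M := by
    rw [hvu, norm_smul, Real.norm_of_nonneg hr0.le]; gcongr
  have hd : dist v u < ρ := by
    rw [dist_eq_norm]
    calc _ ≤ r * M := hn
      _ < ρ / M * M := by gcongr
      _ = ρ := by field_simp
  have h1 := hlit hd hvU
  have h2 := hle v hvU
  have h3 : ⟪R v - R u, e⟫ = ⟪R v - R u - A (v - u), e⟫ + r * ⟪A w', e⟫ := by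
    rw [hvu, map_smul, inner_sub_left (R v - R u), real_inner_smul_left]; ring
  have h4 : -(ε * (r * M) * ‖e‖) ≤ ⟪R v - R u - A (v - u), e⟫ := by
    have := abs_real_inner_le_norm (R v - R u - A (v - u)) e
    have h5 : ‖R v - R u - A (v - u)‖ * ‖e‖ ≤ ε * (r * M) * ‖e‖ := by
      gcongr
      exact h1.trans (by gcongr)
    have := (abs_le.1 this).1
    linarith
  have h6 : ε * (r * M) * ‖e‖ ≤ r * c / 8 := by
    have : ε * M * (‖e‖ + 1) = c / 8 := by rw [hε]; field_simp
    have h7 : ε * M * ‖e‖ ≤ c / 8 := by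
      rw [← this]; gcongr; linarith
    calc _ = r * (ε * M * ‖e‖) := by ring
      _ ≤ r * (c / 8) := by gcongr
      _ = _ := by ring
  have h8 : r * (c / 2) ≤ r * ⟪A w', e⟫ := by
    gcongr; exact le_of_lt hw't.1
  have h9 : ‖v - u‖ ^ 2 ≤ r * (c / 8) := by
    calc _ ≤ (r * M) ^ 2 := by gcongr
      _ = r * (r * M ^ 2) := by ring
      _ ≤ r * (c / (8 * M ^ 2) * M ^ 2) := by gcongr
      _ = _ := by field_simp
  have : 0 < r * c := by positivity
  nlinarith

theorem mono_single {S : Set (Ed d × Ed d)} (hS : MonoSet S) :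
    ∀ᵐ x ∂(volume : Measure (Ed d)), ∀ y₁ y₂, (x, y₁) ∈ S → MonoRel S x y₂ → y₂ = y₁ := by
  classical
  set U : Set (Ed d) := (fun p : Ed d × Ed d => p.1 + p.2) '' S with hU
  have hex : ∀ u : Ed d, ∃ x : Ed d, u ∈ U → (x, u - x) ∈ S := by
    intro u
    by_cases hu : u ∈ U
    · obtain ⟨p, hp, rfl⟩ := hu
      exact ⟨p.1, fun _ => by simpa using hp⟩
    · exact ⟨0, fun h => absurd h hu⟩
  choose R hR using hex
  have hfirm : ∀ u ∈ U, ∀ v ∈ U, ‖R u - R v‖ ^ 2 ≤ ⟪R u - R v, u - v⟫ := by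
    intro u hu v hv
    have := hS _ (hR u hu) _ (hR v hv)
    simp only at this
    have h2 : u - R u - (v - R v) = (u - v) - (R u - R v) := by abel
    rw [h2, inner_sub_right, real_inner_self_eq_norm_sq] at this
    linarith
  have hLip : LipschitzOnWith 1 R U := by
    refine LipschitzOnWith.of_dist_le_mul fun u hu v hv => ?_
    rw [dist_eq_norm, dist_eq_norm, NNReal.coe_one, one_mul]
    have h1 := hfirm u hu v hv
    have h2 := real_inner_le_norm (R u - R v) (u - v)
    by_contra! h
    have h0 : 0 < ‖R u - R v‖ := lt_of_le_of_lt (norm_nonneg _) h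
    nlinarith
  have hRuniq : ∀ p ∈ S, R (p.1 + p.2) = p.1 := by
    intro p hp
    have hu : p.1 + p.2 ∈ U := ⟨p, hp, rfl⟩
    have := hS _ (hR _ hu) _ hp
    simp only at this
    have h2 : p.1 + p.2 - R (p.1 + p.2) - p.2 = -(R (p.1 + p.2) - p.1) := by abel
    rw [h2, inner_neg_right, real_inner_self_eq_norm_sq] at this
    have h3 : ‖R (p.1 + p.2) - p.1‖ = 0 := by
      have := norm_nonneg (R (p.1 + p.2) - p.1)
      nlinarith
    exact sub_eq_zero.1 (norm_eq_zero.1 h3)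
  set B : Set (Ed d) := {u | u ∈ U ∧ ∃ y₂, MonoRel S (R u) y₂ ∧ y₂ ≠ u - R u} with hB
  have hdiff := hLip.ae_differentiableWithinAt_of_mem (μ := volume)
  have hdens := ae_imp_of_ae_restrict
    (Besicovitch.ae_tendsto_measure_inter_div (volume : Measure (Ed d)) U)
  set G : Set (Ed d) := {u | u ∈ U → DifferentiableWithinAt ℝ R U u} ∩ {u | u ∈ U →
    Tendsto (fun r => volume (U ∩ Metric.closedBall u r) / volume (Metric.closedBall u r))
      (𝓝[>] 0) (𝓝 1)} with hG
  have hGnull : volume Gᶜ = 0 := by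
    have : G ∈ ae (volume : Measure (Ed d)) := Filter.inter_mem hdiff hdens
    exact this
  have hN1 : volume (R '' (B ∩ Gᶜ)) = 0 :=
    lip_null (hLip.mono fun u hu => hu.1.1) (measure_mono_null Set.inter_subset_right hGnull)
  have hN2 : volume (R '' (B ∩ G)) = 0 := by
    apply MeasureTheory.addHaar_image_eq_zero_of_det_fderivWithin_eq_zero volume
      (f' := fun u => fderivWithin ℝ R U u)
    · intro u hu
      exact ((hu.2.1 hu.1.1).hasFDerivWithinAt).mono fun v hv => hv.1.1
    · intro u hu
      obtain ⟨⟨huU, y₂, hrel, hne⟩, hg1, hg2⟩ := hu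
      refine det_zero_of_density (hg1 huU).hasFDerivWithinAt (hg2 huU)
        (sub_ne_zero.2 hne) ?_
      intro v hv
      have h1 := hrel _ (hR v hv)
      simp only at h1
      have h2 : v - R v - y₂ = (v - u) - (R v - R u) - (y₂ - (u - R u)) := by abel
      rw [h2, inner_sub_right, inner_sub_right, real_inner_self_eq_norm_sq] at h1
      have h3 := real_inner_le_norm (R v - R u) (v - u)
      have h4 : ‖R v - R u‖ ≤ ‖v - u‖ := by
        have := hLip.dist_le_mul v hv u huU
        simpa [dist_eq_norm] using this
      have h5 : ‖R v - R u‖ * ‖v - u‖ ≤ ‖v - u‖ ^ 2 := by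
        rw [sq]; gcongr
      have := sq_nonneg ‖R v - R u‖
      linarith
  have hN : volume (R '' B) = 0 := by
    rw [← Set.inter_union_compl B G, Set.image_union]
    exact measure_union_null hN2 hN1
  have : ∀ᵐ x ∂(volume : Measure (Ed d)), x ∉ R '' B := measure_eq_zero_iff_ae_notMem.1 hN
  filter_upwards [this] with x hx y₁ y₂ h1 h2
  by_contra hne
  apply hx
  have hRx : R (x + y₁) = x := hRuniq _ h1
  refine ⟨x + y₁, ⟨⟨_, h1, rfl⟩, y₂, ?_, ?_⟩, hRx⟩
  · rw [hRx]; exact h2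
  · rw [hRx]; simpa using hne

end KeyLemma

section Couplings
variable {d : ℕ}

def tcost (θ : Measure (Ed d × Ed d)) : ℝ := ∫ p, ‖p.1 - p.2‖ ^ 2 ∂θ

theorem tcost_nonneg (θ : Measure (Ed d × Ed d)) : 0 ≤ tcost θ :=
  integral_nonneg fun _ => by positivity

theorem bddBelow_costs (μ ν : Measure (Ed d)) : BddBelow (transportCosts μ ν) := by
  refine ⟨0, ?_⟩
  rintro c ⟨θ, -, rfl⟩
  exact tcost_nonneg θ

theorem sInf_costs_nonneg (μ ν : Measure (Ed d)) : 0 ≤ sInf (transportCosts μ ν) := by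
  apply Real.sInf_nonneg
  rintro c ⟨θ, -, rfl⟩
  exact tcost_nonneg θ

theorem W2_sq (μ ν : Measure (Ed d)) : W2 μ ν ^ 2 = sInf (transportCosts μ ν) :=
  Real.sq_sqrt (sInf_costs_nonneg μ ν)

theorem W2_sq_le {μ ν : Measure (Ed d)} {θ : Measure (Ed d × Ed d)} (h : IsCoupling θ μ ν) :
    W2 μ ν ^ 2 ≤ tcost θ := by
  rw [W2_sq]
  exact csInf_le (bddBelow_costs μ ν) ⟨θ, h, rfl⟩

theorem W2_nonneg (μ ν : Measure (Ed d)) : 0 ≤ W2 μ ν := Real.sqrt_nonneg _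

theorem exists_near {μ ν : Measure (Ed d)} (hμ : MemP2 μ) (hν : MemP2 ν) {ε : ℝ} (hε : 0 < ε) :
    ∃ θ, IsCoupling θ μ ν ∧ tcost θ < W2 μ ν ^ 2 + ε := by
  have := hμ.1
  have := hν.1
  have hne : (transportCosts μ ν).Nonempty := by
    refine ⟨_, μ.prod ν, ⟨inferInstance, ?_, ?_⟩, rfl⟩
    · rw [Measure.map_fst_prod]; simp
    · rw [Measure.map_snd_prod]; simp
  obtain ⟨c, ⟨θ, hθ, rfl⟩, hc⟩ := Real.lt_sInf_add_pos hne hε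
  exact ⟨θ, hθ, by rw [W2_sq]; exact hc⟩

theorem IsCoupling.int_fst {μ ν : Measure (Ed d)} {θ : Measure (Ed d × Ed d)}
    (h : IsCoupling θ μ ν) (hμ : MemP2 μ) : Integrable (fun p : Ed d × Ed d => ‖p.1‖ ^ 2) θ := by
  have := hμ.2
  rw [← h.2.1] at this
  exact this.comp_measurable measurable_fst

theorem IsCoupling.int_snd {μ ν : Measure (Ed d)} {θ : Measure (Ed d × Ed d)}
    (h : IsCoupling θ μ ν) (hν : MemP2 ν) : Integrable (fun p : Ed d × Ed d => ‖p.2‖ ^ 2) θ := by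
  have := hν.2
  rw [← h.2.2] at this
  exact this.comp_measurable measurable_snd

theorem norm_sub_sq_le' (a b : Ed d) : ‖a - b‖ ^ 2 ≤ 2 * (‖a‖ ^ 2 + ‖b‖ ^ 2) := by
  have h := norm_sub_le a b
  have h0 := norm_nonneg (a - b)
  nlinarith [sq_nonneg (‖a‖ - ‖b‖)]

theorem int_sub_sq {Ω : Type*} [MeasurableSpace Ω] {m : Measure Ω} {a b : Ω → Ed d}
    (ha : Measurable a) (hb : Measurable b) (ha2 : Integrable (fun z => ‖a z‖ ^ 2) m)
    (hb2 : Integrable (fun z => ‖b z‖ ^ 2) m) : Integrable (fun z => ‖a z - b z‖ ^ 2) m := by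
  refine ((ha2.add hb2).const_mul 2).mono' (by fun_prop) (ae_of_all _ fun z => ?_)
  rw [Real.norm_of_nonneg (by positivity)]
  exact norm_sub_sq_le' _ _

theorem int_inner {Ω : Type*} [MeasurableSpace Ω] {m : Measure Ω} {a b : Ω → Ed d}
    (ha : Measurable a) (hb : Measurable b) (ha2 : Integrable (fun z => ‖a z‖ ^ 2) m)
    (hb2 : Integrable (fun z => ‖b z‖ ^ 2) m) : Integrable (fun z => ⟪a z, b z⟫) m := by
  refine (ha2.add hb2).mono' (by fun_prop) (ae_of_all _ fun z => ?_)
  have := norm_inner_le_norm (𝕜 := ℝ) (a z) (b z)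
  simp only [Pi.add_apply]
  nlinarith [sq_nonneg (‖a z‖ - ‖b z‖), sq_nonneg (‖a z‖), sq_nonneg (‖b z‖)]

theorem IsCoupling.int_cost {μ ν : Measure (Ed d)} {θ : Measure (Ed d × Ed d)}
    (h : IsCoupling θ μ ν) (hμ : MemP2 μ) (hν : MemP2 ν) :
    Integrable (fun p : Ed d × Ed d => ‖p.1 - p.2‖ ^ 2) θ :=
  int_sub_sq measurable_fst measurable_snd (h.int_fst hμ) (h.int_snd hν)

theorem int_fst_prod {σ γ : Measure (Ed d × Ed d)} [IsProbabilityMeasure σ]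
    [IsProbabilityMeasure γ] {g : Ed d × Ed d → ℝ} (hg : Integrable g σ) :
    Integrable (fun z : (Ed d × Ed d) × (Ed d × Ed d) => g z.1) (σ.prod γ) :=
  hg.comp_fst γ

theorem int_snd_prod {σ γ : Measure (Ed d × Ed d)} [IsProbabilityMeasure σ]
    [IsProbabilityMeasure γ] {g : Ed d × Ed d → ℝ} (hg : Integrable g γ) :
    Integrable (fun z : (Ed d × Ed d) × (Ed d × Ed d) => g z.2) (σ.prod γ) :=
  hg.comp_snd σ

/-- The negative part of the monotonicity defect. -/
def defect (p q : Ed d × Ed d) : ℝ := max 0 (-⟪p.1 - q.1, p.2 - q.2⟫)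

theorem defect_nonneg (p q : Ed d × Ed d) : 0 ≤ defect p q := le_max_left _ _

theorem continuous_defect :
    Continuous (fun z : (Ed d × Ed d) × (Ed d × Ed d) => defect z.1 z.2) := by
  unfold defect; fun_prop

theorem int_defect {μ ν : Measure (Ed d)} (hμ : MemP2 μ) (hν : MemP2 ν)
    {σ γ : Measure (Ed d × Ed d)} (hσ : IsCoupling σ μ ν) (hγ : IsCoupling γ μ ν) :
    Integrable (fun z : (Ed d × Ed d) × (Ed d × Ed d) => defect z.1 z.2) (σ.prod γ) := by
  have := hσ.1
  have := hγ.1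
  have h1 := int_fst_prod (γ := γ) (hσ.int_fst hμ)
  have h2 := int_fst_prod (γ := γ) (hσ.int_snd hν)
  have h3 := int_snd_prod (σ := σ) (hγ.int_fst hμ)
  have h4 := int_snd_prod (σ := σ) (hγ.int_snd hν)
  have h5 := int_sub_sq (by fun_prop) (by fun_prop) h1 h3
  have h6 := int_sub_sq (by fun_prop) (by fun_prop) h2 h4
  have h7 := int_inner (by fun_prop) (by fun_prop) h5 h6
  exact (integrable_zero _ _ _).sup h7.neg

theorem swap_ineq {μ ν : Measure (Ed d)} (hμ : MemP2 μ) (hν : MemP2 ν)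
    {σ γ : Measure (Ed d × Ed d)} (hσ : IsCoupling σ μ ν) (hγ : IsOptimalCoupling γ μ ν) :
    ∫ z, defect z.1 z.2 ∂(σ.prod γ) ≤ (tcost σ - tcost γ) / 2 := by
  classical
  have := hσ.1
  have := hγ.1.1
  set m := σ.prod γ with hm
  set A : Set ((Ed d × Ed d) × (Ed d × Ed d)) := {z | ⟪z.1.1 - z.2.1, z.1.2 - z.2.2⟫ < 0} with hA
  have hAm : MeasurableSet A :=
    (isOpen_lt (by fun_prop) continuous_const).measurableSet
  set Y₁ : (Ed d × Ed d) × (Ed d × Ed d) → Ed d := fun z => if z ∈ A then z.2.2 else z.1.2 with hY₁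
  set Y₂ : (Ed d × Ed d) × (Ed d × Ed d) → Ed d := fun z => if z ∈ A then z.1.2 else z.2.2 with hY₂
  have hY₁m : Measurable Y₁ := Measurable.ite hAm (by fun_prop) (by fun_prop)
  have hY₂m : Measurable Y₂ := Measurable.ite hAm (by fun_prop) (by fun_prop)
  set P : (Ed d × Ed d) × (Ed d × Ed d) → Ed d × Ed d := fun z => (z.1.1, Y₁ z) with hP
  set Q : (Ed d × Ed d) × (Ed d × Ed d) → Ed d × Ed d := fun z => (z.2.1, Y₂ z) with hQ
  have hPm : Measurable P := by fun_prop
  have hQm : Measurable Q := by fun_prop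
  have m1 : m.map Prod.fst = σ := by rw [hm, Measure.map_fst_prod]; simp
  have m2 : m.map Prod.snd = γ := by rw [hm, Measure.map_snd_prod]; simp
  have mx1 : m.map (fun z => z.1.1) = μ := by
    rw [← hσ.2.1, ← m1, Measure.map_map measurable_fst measurable_fst]; rfl
  have my1 : m.map (fun z => z.1.2) = ν := by
    rw [← hσ.2.2, ← m1, Measure.map_map measurable_snd measurable_fst]; rfl
  have mx2 : m.map (fun z => z.2.1) = μ := by
    rw [← hγ.1.2.1, ← m2, Measure.map_map measurable_fst measurable_snd]; rfl
  have my2 : m.map (fun z => z.2.2) = ν := by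
    rw [← hγ.1.2.2, ← m2, Measure.map_map measurable_snd measurable_snd]; rfl
  have hhalf : ∀ κ : Measure (Ed d), (2⁻¹ : ℝ≥0∞) • (κ + κ) = κ := by
    intro κ
    rw [← two_smul ℝ≥0∞ κ, smul_smul, ENNReal.inv_mul_cancel (by simp) (by simp), one_smul]
  have hYY : m.map Y₁ + m.map Y₂ = ν + ν := by
    conv_rhs => rw [← my1]
    conv_rhs => arg 2; rw [my1, ← my2]
    ext B hB
    simp only [Measure.add_apply]
    rw [Measure.map_apply hY₁m hB, Measure.map_apply hY₂m hB,
      Measure.map_apply (by fun_prop) hB, Measure.map_apply (by fun_prop) hB,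
      ← measure_inter_add_sdiff (Y₁ ⁻¹' B) hAm, ← measure_inter_add_sdiff (Y₂ ⁻¹' B) hAm,
      ← measure_inter_add_sdiff ((fun z : (Ed d × Ed d) × (Ed d × Ed d) => z.1.2) ⁻¹' B) hAm,
      ← measure_inter_add_sdiff ((fun z : (Ed d × Ed d) × (Ed d × Ed d) => z.2.2) ⁻¹' B) hAm]
    have e1 : Y₁ ⁻¹' B ∩ A = (fun z : (Ed d × Ed d) × (Ed d × Ed d) => z.2.2) ⁻¹' B ∩ A := by
      ext z; by_cases hz : z ∈ A <;> simp [hY₁, hz]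
    have e2 : Y₁ ⁻¹' B \ A = (fun z : (Ed d × Ed d) × (Ed d × Ed d) => z.1.2) ⁻¹' B \ A := by
      ext z; by_cases hz : z ∈ A <;> simp [hY₁, hz]
    have e3 : Y₂ ⁻¹' B ∩ A = (fun z : (Ed d × Ed d) × (Ed d × Ed d) => z.1.2) ⁻¹' B ∩ A := by
      ext z; by_cases hz : z ∈ A <;> simp [hY₂, hz]
    have e4 : Y₂ ⁻¹' B \ A = (fun z : (Ed d × Ed d) × (Ed d × Ed d) => z.2.2) ⁻¹' B \ A := by
      ext z; by_cases hz : z ∈ A <;> simp [hY₂, hz]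
    rw [e1, e2, e3, e4]
    ring
  set ρ : Measure (Ed d × Ed d) := (2⁻¹ : ℝ≥0∞) • (m.map P + m.map Q) with hρ
  have hfst : ρ.map Prod.fst = μ := by
    rw [hρ, Measure.map_smul, Measure.map_add _ _ measurable_fst,
      Measure.map_map measurable_fst hPm, Measure.map_map measurable_fst hQm]
    have : (Prod.fst ∘ P) = fun z => z.1.1 := rfl
    rw [this, mx1]
    have : (Prod.fst ∘ Q) = fun z => z.2.1 := rfl
    rw [this, mx2, hhalf]
  have hsnd : ρ.map Prod.snd = ν := by
    rw [hρ, Measure.map_smul, Measure.map_add _ _ measurable_snd,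
      Measure.map_map measurable_snd hPm, Measure.map_map measurable_snd hQm]
    have : (Prod.snd ∘ P) = Y₁ := rfl
    rw [this]
    have : (Prod.snd ∘ Q) = Y₂ := rfl
    rw [this, hYY, hhalf]
  have hρprob : IsProbabilityMeasure ρ := by
    have := hμ.1
    refine ⟨?_⟩
    have : ρ.map Prod.fst Set.univ = 1 := by rw [hfst]; simp
    rwa [Measure.map_apply measurable_fst MeasurableSet.univ] at this
  have hρc : IsCoupling ρ μ ν := ⟨hρprob, hfst, hsnd⟩
  have hopt : tcost γ ≤ tcost ρ := by
    have := W2_sq_le hρc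
    rw [← hγ.2] at this
    exact this
  have hint := hρc.int_cost hμ hν
  have hintPQ : Integrable (fun p : Ed d × Ed d => ‖p.1 - p.2‖ ^ 2) (m.map P + m.map Q) := by
    rw [hρ] at hint
    exact (integrable_smul_measure (by simp) (by simp)).1 hint
  have hiP := hintPQ.left_of_add_measure
  have hiQ := hintPQ.right_of_add_measure
  have hiP' : Integrable (fun z => ‖(P z).1 - (P z).2‖ ^ 2) m := hiP.comp_measurable hPm
  have hiQ' : Integrable (fun z => ‖(Q z).1 - (Q z).2‖ ^ 2) m := hiQ.comp_measurable hQm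
  have hcρ : tcost ρ = 2⁻¹ * (∫ z, ‖(P z).1 - (P z).2‖ ^ 2 + ‖(Q z).1 - (Q z).2‖ ^ 2 ∂m) := by
    rw [tcost, hρ, integral_smul_measure, integral_add_measure hiP hiQ,
      integral_map hPm.aemeasurable hiP.1, integral_map hQm.aemeasurable hiQ.1,
      integral_add hiP' hiQ']
    simp
  have hpt : ∀ z, ‖(P z).1 - (P z).2‖ ^ 2 + ‖(Q z).1 - (Q z).2‖ ^ 2 =
      (‖z.1.1 - z.1.2‖ ^ 2 + ‖z.2.1 - z.2.2‖ ^ 2) - 2 * defect z.1 z.2 := by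
    intro z
    by_cases hz : z ∈ A
    · have hz' : ⟪z.1.1 - z.2.1, z.1.2 - z.2.2⟫ < 0 := hz
      simp only [hP, hQ, hY₁, hY₂, hz, if_true, defect]
      rw [max_eq_right (by linarith)]
      simp only [norm_sub_sq_real, inner_sub_left, inner_sub_right]
      ring
    · have hz' : 0 ≤ ⟪z.1.1 - z.2.1, z.1.2 - z.2.2⟫ := not_lt.1 hz
      simp only [hP, hQ, hY₁, hY₂, hz, if_false, defect]
      rw [max_eq_left (by linarith)]
      ring
  have hc1 := int_fst_prod (γ := γ) (hσ.int_cost hμ hν)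
  have hc2 := int_snd_prod (σ := σ) (hγ.1.int_cost hμ hν)
  have hc3 := int_defect hμ hν hσ hγ.1
  have e1 : ∫ z, ‖z.1.1 - z.1.2‖ ^ 2 ∂m = tcost σ := by
    rw [tcost]
    conv_rhs => rw [← m1]
    rw [integral_map measurable_fst.aemeasurable (by fun_prop)]
  have e2 : ∫ z, ‖z.2.1 - z.2.2‖ ^ 2 ∂m = tcost γ := by
    rw [tcost]
    conv_rhs => rw [← m2]
    rw [integral_map measurable_snd.aemeasurable (by fun_prop)]
  simp_rw [hpt] at hcρ
  have hc12 : Integrable (fun z : (Ed d × Ed d) × (Ed d × Ed d) =>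
      ‖z.1.1 - z.1.2‖ ^ 2 + ‖z.2.1 - z.2.2‖ ^ 2) m := hc1.add hc2
  rw [integral_sub hc12 (hc3.const_mul 2), integral_add hc1 hc2, integral_const_mul,
    e1, e2] at hcρ
  linarith

theorem support_mono_of_optimal {μ ν : Measure (Ed d)} (hμ : MemP2 μ) (hν : MemP2 ν)
    {γ : Measure (Ed d × Ed d)} (hγ : IsOptimalCoupling γ μ ν) : MonoSet γ.support := by
  have := hγ.1.1
  have h1 := swap_ineq hμ hν hγ.1 hγ
  rw [sub_self, zero_div] at h1
  have h2 : ∫ z, defect z.1 z.2 ∂(γ.prod γ) = 0 :=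
    le_antisymm h1 (integral_nonneg fun z => defect_nonneg _ _)
  rw [integral_eq_zero_iff_of_nonneg (fun z => defect_nonneg _ _) (int_defect hμ hν hγ.1 hγ.1)] at h2
  intro p hp q hq
  by_contra! hneg
  have hopen : IsOpen {z : (Ed d × Ed d) × (Ed d × Ed d) | ⟪z.1.1 - z.2.1, z.1.2 - z.2.2⟫ < 0} :=
    isOpen_lt (by fun_prop) continuous_const
  obtain ⟨V, W, hV, hW, hpV, hqW, hVW⟩ := isOpen_prod_iff.1 hopen p q hneg
  have hpos : 0 < (γ.prod γ) (V ×ˢ W) := by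
    rw [Measure.prod_prod]
    exact ENNReal.mul_pos ((Measure.mem_support_iff_forall p).1 hp V (hV.mem_nhds hpV)).ne'
      ((Measure.mem_support_iff_forall q).1 hq W (hW.mem_nhds hqW)).ne'
  refine hpos.ne' (measure_mono_null ?_ h2)
  intro z hz
  have h3 : ⟪z.1.1 - z.2.1, z.1.2 - z.2.2⟫ < 0 := hVW hz
  intro h4
  have h4 : defect z.1 z.2 = 0 := h4
  have := le_max_right 0 (-⟪z.1.1 - z.2.1, z.1.2 - z.2.2⟫)
  rw [defect] at h4
  linarith

end Couplings

section Potential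
variable {d : ℕ}

theorem exists_map {μ ν : Measure (Ed d)} (hμ : MemP2 μ) (hν : MemP2 ν)
    (hμac : μ ≪ (volume : Measure (Ed d)))
    {γ : Measure (Ed d × Ed d)} (hγ : IsOptimalCoupling γ μ ν) :
    ∃ T : Ed d → Ed d, Measurable T ∧ (∀ᵐ p ∂γ, p.2 = T p.1) ∧
      ∀ᵐ x ∂μ, ∀ y, MonoRel γ.support x y → y = T x := by
  have := hγ.1.1
  have hmono := support_mono_of_optimal hμ hν hγ
  have hN := hμac.ae_le (mono_single hmono)
  have hS : ∀ᵐ p ∂γ, p ∈ γ.support := Measure.support_mem_ae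
  have hfst : γ.fst = μ := hγ.1.2.1
  have hdis : γ.fst ⊗ₘ γ.condKernel = γ := γ.disintegrate γ.condKernel
  have hS2 : ∀ᵐ x ∂μ, ∀ᵐ y ∂(γ.condKernel x), (x, y) ∈ γ.support := by
    rw [← hfst]
    apply Measure.ae_ae_of_ae_compProd
    rw [hdis]; exact hS
  have hT : ∀ᵐ x ∂μ, (x, ∫ y, y ∂(γ.condKernel x)) ∈ γ.support := by
    filter_upwards [hN, hS2] with x h1 h2
    obtain ⟨y₀, hy₀⟩ := h2.exists
    have h3 : (fun y => y) =ᵐ[γ.condKernel x] fun _ => y₀ := by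
      filter_upwards [h2] with y hy
      exact h1 _ _ hy₀ (fun q hq => hmono q hq _ hy)
    rw [integral_congr_ae h3]
    simpa using hy₀
  have hgood : ∀ᵐ x ∂μ, ∀ y, MonoRel γ.support x y → y = ∫ y, y ∂(γ.condKernel x) := by
    filter_upwards [hN, hT] with x h1 h2 y hy
    exact h1 _ _ h2 hy
  refine ⟨fun x => ∫ y, y ∂(γ.condKernel x), ?_, ?_, hgood⟩
  · exact (StronglyMeasurable.integral_kernel (κ := γ.condKernel)
      (f := fun y : Ed d => y) stronglyMeasurable_id).measurable
  · rw [← hγ.1.2.1] at hgood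
    filter_upwards [hS, ae_of_ae_map measurable_fst.aemeasurable hgood] with p h1 h2
    exact h2 _ (fun q hq => hmono q hq _ h1)

/-- averaged monotonicity defect -/
def FF (γ : Measure (Ed d × Ed d)) (p : Ed d × Ed d) : ℝ := ∫ q, defect p q ∂γ

theorem FF_nonneg (γ : Measure (Ed d × Ed d)) (p : Ed d × Ed d) : 0 ≤ FF γ p :=
  integral_nonneg fun _ => defect_nonneg _ _

theorem FF_meas (γ : Measure (Ed d × Ed d)) [IsProbabilityMeasure γ] : Measurable (FF γ) := by
  have h : StronglyMeasurable (fun z : (Ed d × Ed d) × (Ed d × Ed d) => defect z.1 z.2) :=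
    continuous_defect.stronglyMeasurable
  exact h.integral_prod_right.measurable

theorem int_defect_right {μ ν : Measure (Ed d)} (hμ : MemP2 μ) (hν : MemP2 ν)
    {γ : Measure (Ed d × Ed d)} (hγ : IsCoupling γ μ ν) (p : Ed d × Ed d) :
    Integrable (fun q => defect p q) γ := by
  have := hγ.1
  have h1 := int_sub_sq (a := fun _ => p.1) (by fun_prop) (by fun_prop)
    (integrable_const _) (hγ.int_fst hμ)
  have h2 := int_sub_sq (a := fun _ => p.2) (by fun_prop) (by fun_prop)
    (integrable_const _) (hγ.int_snd hν)
  have h7 := int_inner (by fun_prop) (by fun_prop) h1 h2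
  exact (integrable_zero _ _ _).sup h7.neg

theorem FF_cont {μ ν : Measure (Ed d)} (hμ : MemP2 μ) (hν : MemP2 ν)
    {γ : Measure (Ed d × Ed d)} (hγ : IsCoupling γ μ ν) (x : Ed d) :
    Continuous (fun y => FF γ (x, y)) := by
  have := hγ.1
  have h1 := int_sub_sq (a := fun _ => x) (by fun_prop) (by fun_prop)
    (integrable_const _) (hγ.int_fst hμ)
  have h2 : Integrable (fun q : Ed d × Ed d => ‖x - q.1‖) γ := by
    refine (h1.add (integrable_const 1)).mono' (by fun_prop) (ae_of_all _ fun q => ?_)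
    simp only [norm_norm, Pi.add_apply]
    nlinarith [sq_nonneg (‖x - q.1‖ - 1), norm_nonneg (x - q.1)]
  have hL : LipschitzWith (Real.toNNReal (∫ q, ‖x - q.1‖ ∂γ)) (fun y => FF γ (x, y)) := by
    refine LipschitzWith.of_dist_le_mul fun y y' => ?_
    rw [Real.coe_toNNReal _ (integral_nonneg fun _ => norm_nonneg _), Real.dist_eq, dist_eq_norm,
      FF, FF, ← integral_sub (int_defect_right hμ hν hγ _) (int_defect_right hμ hν hγ _),
      ← integral_mul_const, ← Real.norm_eq_abs]
    refine norm_integral_le_of_norm_le (h2.mul_const _) (ae_of_all _ fun q => ?_)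
    rw [Real.norm_eq_abs]
    refine (abs_max_sub_max_le_max _ _ _ _).trans ?_
    simp only [sub_self, abs_zero]
    rw [max_eq_right (abs_nonneg _)]
    have : -⟪x - q.1, y - q.2⟫ - -⟪x - q.1, y' - q.2⟫ = -⟪x - q.1, y - y'⟫ := by
      simp only [inner_sub_right]; ring
    rw [this, abs_neg]
    exact abs_real_inner_le_norm _ _
  exact hL.continuous

theorem monoRel_of_FF {μ ν : Measure (Ed d)} (hμ : MemP2 μ) (hν : MemP2 ν)
    {γ : Measure (Ed d × Ed d)} (hγ : IsCoupling γ μ ν) {x y : Ed d} (h : FF γ (x, y) = 0) :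
    MonoRel γ.support x y := by
  have := hγ.1
  rw [FF, integral_eq_zero_iff_of_nonneg (fun q => defect_nonneg _ _)
    (int_defect_right hμ hν hγ _)] at h
  have hcl : IsClosed {q : Ed d × Ed d | 0 ≤ ⟪q.1 - x, q.2 - y⟫} :=
    isClosed_le continuous_const (by fun_prop)
  have hsub := Measure.support_subset_of_isClosed (μ := γ) hcl (by
    filter_upwards [h] with q hq
    have hq : max 0 (-⟪x - q.1, y - q.2⟫) = 0 := hq
    have h2 := le_max_right 0 (-⟪x - q.1, y - q.2⟫)
    rw [hq] at h2
    have h3 : ⟪q.1 - x, q.2 - y⟫ = ⟪x - q.1, y - q.2⟫ := by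
      rw [← neg_sub x, ← neg_sub y, inner_neg_neg]
    show 0 ≤ ⟪q.1 - x, q.2 - y⟫
    linarith)
  exact fun q hq => hsub hq

theorem lint_FF {μ ν : Measure (Ed d)} (hμ : MemP2 μ) (hν : MemP2 ν)
    {σ γ : Measure (Ed d × Ed d)} (hσ : IsCoupling σ μ ν) (hγ : IsOptimalCoupling γ μ ν) :
    ∫⁻ p, ENNReal.ofReal (FF γ p) ∂σ ≤ ENNReal.ofReal ((tcost σ - tcost γ) / 2) := by
  have := hσ.1
  have := hγ.1.1
  have h1 := int_defect hμ hν hσ hγ.1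
  have h2 := swap_ineq hμ hν hσ hγ
  rw [integral_prod _ h1] at h2
  have h3 : Integrable (FF γ) σ := h1.integral_prod_left
  rw [← ofReal_integral_eq_lintegral_ofReal h3 (ae_of_all _ fun p => FF_nonneg _ _)]
  exact ENNReal.ofReal_le_ofReal h2

instance ballNonempty (M : ℕ) : Nonempty (Metric.closedBall (0 : Ed d) (M : ℝ)) := ⟨⟨0, by simp⟩⟩

/-- a dense sequence in the closed ball -/
def dseq (d M : ℕ) (i : ℕ) : Ed d :=
  (TopologicalSpace.denseSeq (Metric.closedBall (0 : Ed d) (M : ℝ)) i).1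

theorem dseq_mem (d M i : ℕ) : dseq d M i ∈ Metric.closedBall (0 : Ed d) (M : ℝ) :=
  (TopologicalSpace.denseSeq (Metric.closedBall (0 : Ed d) (M : ℝ)) i).2

theorem dense_dseq (M : ℕ) {C : Set (Ed d)} (hC : IsClosed C) (h : ∀ i, dseq d M i ∈ C)
    {y : Ed d} (hy : ‖y‖ ≤ M) : y ∈ C := by
  have hcl : IsClosed {z : Metric.closedBall (0 : Ed d) (M : ℝ) | (z : Ed d) ∈ C} :=
    hC.preimage continuous_subtype_val
  have h2 : Dense {z : Metric.closedBall (0 : Ed d) (M : ℝ) | (z : Ed d) ∈ C} := by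
    refine (TopologicalSpace.denseRange_denseSeq _).mono ?_
    rintro _ ⟨i, rfl⟩
    exact h i
  have h3 := h2.closure_eq
  rw [hcl.closure_eq] at h3
  have h4 : (⟨y, by simpa using hy⟩ : Metric.closedBall (0 : Ed d) (M : ℝ)) ∈
    {z : Metric.closedBall (0 : Ed d) (M : ℝ) | (z : Ed d) ∈ C} := h3 ▸ Set.mem_univ _
  exact h4

/-- penalized truncated distance -/
def pen (γ : Measure (Ed d × Ed d)) (T : Ed d → Ed d) (M n : ℕ) (x y : Ed d) : ℝ :=
  min (‖y - T x‖ ^ 2) (4 * (M : ℝ) ^ 2) - n * FF γ (x, y)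

/-- the penalized supremum -/
def hh (γ : Measure (Ed d × Ed d)) (T : Ed d → Ed d) (M : ℕ) (n : ℕ) (x : Ed d) : ℝ≥0∞ :=
  ⨆ i : ℕ, ENNReal.ofReal (pen γ T M n x (dseq d M i))

theorem hh_meas (γ : Measure (Ed d × Ed d)) [IsProbabilityMeasure γ] {T : Ed d → Ed d}
    (hT : Measurable T) (M n : ℕ) : Measurable (hh γ T M n) := by
  unfold hh pen
  refine Measurable.iSup fun i => ?_
  have := FF_meas γ
  fun_prop

theorem le_hh {μ ν : Measure (Ed d)} (hμ : MemP2 μ) (hν : MemP2 ν)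
    {γ : Measure (Ed d × Ed d)} (hγ : IsCoupling γ μ ν) (T : Ed d → Ed d)
    (M n : ℕ) (x y : Ed d) (hy : ‖y‖ ≤ M) :
    ENNReal.ofReal (pen γ T M n x y) ≤ hh γ T M n x := by
  have hc := FF_cont hμ hν hγ x
  have hcont : Continuous (fun y => pen γ T M n x y) := by
    unfold pen
    fun_prop
  have hcont2 : Continuous (fun y => ENNReal.ofReal (pen γ T M n x y)) :=
    ENNReal.continuous_ofReal.comp hcont
  have hcl : IsClosed {y : Ed d | ENNReal.ofReal (pen γ T M n x y) ≤ hh γ T M n x} :=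
    isClosed_le hcont2 continuous_const
  exact dense_dseq M hcl (fun i => le_iSup
    (fun i : ℕ => ENNReal.ofReal (pen γ T M n x (dseq d M i))) i) hy

theorem hh_le (γ : Measure (Ed d × Ed d)) (T : Ed d → Ed d) (M n : ℕ) (x : Ed d) :
    hh γ T M n x ≤ ENNReal.ofReal (4 * (M : ℝ) ^ 2) := by
  refine iSup_le fun i => ENNReal.ofReal_le_ofReal ?_
  unfold pen
  have h1 := min_le_right (‖(dseq d M i) - T x‖ ^ 2) (4 * (M : ℝ) ^ 2)
  have h2 : 0 ≤ (n : ℝ) * FF γ (x, (dseq d M i)) :=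
    mul_nonneg (Nat.cast_nonneg _) (FF_nonneg _ _)
  linarith

theorem hh_tendsto {μ ν : Measure (Ed d)} (hμ : MemP2 μ) (hν : MemP2 ν)
    {γ : Measure (Ed d × Ed d)} (hγ : IsCoupling γ μ ν) (T : Ed d → Ed d) (M : ℕ) (x : Ed d)
    (hx : ∀ y, MonoRel γ.support x y → y = T x) :
    Tendsto (fun n => hh γ T M n x) atTop (𝓝 0) := by
  rw [ENNReal.tendsto_nhds_zero]
  intro ε hε
  rcases eq_or_ne ε ⊤ with rfl | hεt
  · simp
  set e : ℝ := ε.toReal with he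
  have he0 : 0 < e := ENNReal.toReal_pos hε.ne' hεt
  have hεe : ε = ENNReal.ofReal e := (ENNReal.ofReal_toReal hεt).symm
  have hc := FF_cont hμ hν hγ x
  set K : Set (Ed d) := Metric.closedBall 0 M ∩ {y | e ≤ ‖y - T x‖ ^ 2} with hK
  have hKc : IsCompact K :=
    (isCompact_closedBall _ _).inter_right (isClosed_le continuous_const (by fun_prop))
  have hpos : ∀ y ∈ K, 0 < FF γ (x, y) := by
    intro y hy
    refine lt_of_le_of_ne (FF_nonneg _ _) fun h => ?_
    have := hx y (monoRel_of_FF hμ hν hγ h.symm)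
    have h2 : e ≤ ‖y - T x‖ ^ 2 := hy.2
    rw [this] at h2
    simp at h2
    linarith
  obtain ⟨c, hc0, hcK⟩ : ∃ c : ℝ, 0 < c ∧ ∀ y ∈ K, c ≤ FF γ (x, y) := by
    rcases K.eq_empty_or_nonempty with h | h
    · exact ⟨1, one_pos, by simp [h]⟩
    · obtain ⟨y₀, hy₀, hmin⟩ := hKc.exists_isMinOn h hc.continuousOn
      exact ⟨_, hpos y₀ hy₀, fun y hy => hmin hy⟩
  filter_upwards [eventually_ge_atTop ⌈4 * (M : ℝ) ^ 2 / c⌉₊] with n hn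
  have hn' : 4 * (M : ℝ) ^ 2 ≤ n * c := by
    have := (Nat.le_ceil _).trans (Nat.cast_le (α := ℝ).2 hn)
    rwa [div_le_iff₀ hc0] at this
  rw [hεe]
  refine iSup_le fun i => ENNReal.ofReal_le_ofReal ?_
  set z : Ed d := dseq d M i with hz
  unfold pen
  have hF := FF_nonneg γ (x, (z : Ed d))
  have hnF : 0 ≤ (n : ℝ) * FF γ (x, (z : Ed d)) := by positivity
  by_cases hzK : (z : Ed d) ∈ K
  · have h1 := hcK _ hzK
    have h2 : (n : ℝ) * c ≤ n * FF γ (x, (z : Ed d)) := by gcongr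
    have h3 := min_le_right (‖(z : Ed d) - T x‖ ^ 2) (4 * (M : ℝ) ^ 2)
    linarith
  · have h1 : ‖(z : Ed d) - T x‖ ^ 2 < e := by
      by_contra! h
      exact hzK ⟨dseq_mem d M i, h⟩
    have h3 := min_le_left (‖(z : Ed d) - T x‖ ^ 2) (4 * (M : ℝ) ^ 2)
    linarith

end Potential

section Conv
variable {d : ℕ}

/-- tail second moment integrand -/
def tl (M : ℕ) (y : Ed d) : ℝ≥0∞ :=
  {y : Ed d | (M : ℝ) < ‖y‖}.indicator (fun y => ENNReal.ofReal (4 * ‖y‖ ^ 2)) y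

theorem tl_meas (M : ℕ) : Measurable (tl (d := d) M) := by
  refine Measurable.indicator (by fun_prop) ?_
  exact (isOpen_lt continuous_const continuous_norm).measurableSet

theorem tl_tendsto {ν : Measure (Ed d)} (hν : MemP2 ν) :
    Tendsto (fun M => ∫⁻ y, tl M y ∂ν) atTop (𝓝 0) := by
  have h : Tendsto (fun M => ∫⁻ y, tl M y ∂ν) atTop (𝓝 (∫⁻ _, 0 ∂ν)) := by
    refine tendsto_lintegral_of_dominated_convergence (fun y => ENNReal.ofReal (4 * ‖y‖ ^ 2))
      (fun M => tl_meas M) (fun M => ae_of_all _ fun y => ?_) ?_ (ae_of_all _ fun y => ?_)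
    · exact Set.indicator_le_self _ _ _
    · exact ((hν.2.const_mul 4).lintegral_lt_top).ne
    · refine tendsto_const_nhds.congr' ?_
      filter_upwards [eventually_ge_atTop ⌈‖y‖⌉₊] with M hM
      have : ‖y‖ ≤ M := (Nat.le_ceil _).trans (Nat.cast_le.2 hM)
      rw [tl, Set.indicator_of_notMem]
      exact not_lt.2 this
  simpa using h

theorem pointwise_bound {μ ν : Measure (Ed d)} (hμ : MemP2 μ) (hν : MemP2 ν)
    {γ : Measure (Ed d × Ed d)} (hγ : IsCoupling γ μ ν) (T : Ed d → Ed d) (M n : ℕ)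
    (p : Ed d × Ed d) :
    ENNReal.ofReal (‖p.2 - T p.1‖ ^ 2) ≤
      (hh γ T M n p.1 + n * ENNReal.ofReal (FF γ p)) + (tl M p.2 + tl M (T p.1)) := by
  obtain ⟨x, y⟩ := p
  simp only
  have htri := norm_sub_le y (T x)
  have h0 := norm_nonneg (y - T x)
  by_cases hle : ‖y‖ ≤ M ∧ ‖T x‖ ≤ M
  · have h1 : ‖y - T x‖ ^ 2 ≤ 4 * (M : ℝ) ^ 2 := by nlinarith [hle.1, hle.2]
    have h2 := le_hh hμ hν hγ T M n x y hle.1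
    have h3 : ‖y - T x‖ ^ 2 = pen γ T M n x y + n * FF γ (x, y) := by
      rw [pen, min_eq_left h1]; ring
    calc ENNReal.ofReal (‖y - T x‖ ^ 2)
        ≤ ENNReal.ofReal (pen γ T M n x y) + ENNReal.ofReal (n * FF γ (x, y)) := by
          rw [h3]; exact ENNReal.ofReal_add_le
      _ ≤ hh γ T M n x + n * ENNReal.ofReal (FF γ (x, y)) := by
          rw [ENNReal.ofReal_mul (Nat.cast_nonneg _), ENNReal.ofReal_natCast]
          gcongr
      _ ≤ _ := le_self_add
  · refine le_trans ?_ le_add_self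
    rcases le_total ‖y‖ ‖T x‖ with h | h
    · have h1 : (M : ℝ) < ‖T x‖ := by
        by_contra! h2
        exact hle ⟨h.trans h2, h2⟩
      refine le_trans ?_ le_add_self
      rw [tl, Set.indicator_of_mem (show T x ∈ {y : Ed d | (M : ℝ) < ‖y‖} from h1)]
      apply ENNReal.ofReal_le_ofReal
      nlinarith
    · have h1 : (M : ℝ) < ‖y‖ := by
        by_contra! h2
        exact hle ⟨h2, h.trans h2⟩
      refine le_trans ?_ le_self_add
      rw [tl, Set.indicator_of_mem (show y ∈ {y : Ed d | (M : ℝ) < ‖y‖} from h1)]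
      apply ENNReal.ofReal_le_ofReal
      nlinarith [norm_nonneg (T x)]

theorem map_conv {μ ν : Measure (Ed d)} (hμ : MemP2 μ) (hν : MemP2 ν)
    {γ : Measure (Ed d × Ed d)} (hγ : IsOptimalCoupling γ μ ν) {T : Ed d → Ed d}
    (hT : Measurable T) (hTγ : ∀ᵐ p ∂γ, p.2 = T p.1)
    (hgood : ∀ᵐ x ∂μ, ∀ y, MonoRel γ.support x y → y = T x)
    (σ : ℕ → Measure (Ed d × Ed d)) (hσ : ∀ k, IsCoupling (σ k) μ ν)
    (hlim : Tendsto (fun k => tcost (σ k)) atTop (𝓝 (tcost γ))) :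
    Tendsto (fun k => ∫⁻ p, ENNReal.ofReal (‖p.2 - T p.1‖ ^ 2) ∂(σ k)) atTop (𝓝 0) := by
  have := hγ.1.1
  have := hμ.1
  have hμT : μ.map T = ν := by
    rw [← hγ.1.2.1, ← hγ.1.2.2, Measure.map_map hT measurable_fst]
    exact Measure.map_congr (hTγ.mono fun p hp => hp.symm)
  have hhlim : ∀ M, Tendsto (fun n => ∫⁻ x, hh γ T M n x ∂μ) atTop (𝓝 0) := by
    intro M
    have h : Tendsto (fun n => ∫⁻ x, hh γ T M n x ∂μ) atTop (𝓝 (∫⁻ _, 0 ∂μ)) := by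
      refine tendsto_lintegral_of_dominated_convergence (fun _ => ENNReal.ofReal (4 * (M : ℝ) ^ 2))
        (fun n => hh_meas γ hT M n) (fun n => ae_of_all _ fun x => hh_le _ _ _ _ _) ?_ ?_
      · rw [lintegral_const, measure_univ, mul_one]
        exact ENNReal.ofReal_ne_top
      · filter_upwards [hgood] with x hx
        exact hh_tendsto hμ hν hγ.1 T M x hx
    simpa using h
  have hFm := FF_meas γ
  have hbound : ∀ M n k, ∫⁻ p, ENNReal.ofReal (‖p.2 - T p.1‖ ^ 2) ∂(σ k) ≤
      (∫⁻ x, hh γ T M n x ∂μ + n * ENNReal.ofReal ((tcost (σ k) - tcost γ) / 2)) +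
        (∫⁻ y, tl M y ∂ν + ∫⁻ y, tl M y ∂ν) := by
    intro M n k
    have hm1 := hh_meas γ hT M n
    have hm2 := tl_meas (d := d) M
    refine (lintegral_mono (pointwise_bound hμ hν hγ.1 T M n)).trans ?_
    rw [lintegral_add_left (by fun_prop), lintegral_add_left (by fun_prop),
      lintegral_add_left (by fun_prop), lintegral_const_mul _ (by fun_prop)]
    have e1 : ∫⁻ p, hh γ T M n p.1 ∂(σ k) = ∫⁻ x, hh γ T M n x ∂μ := by
      rw [← (hσ k).2.1, lintegral_map hm1 measurable_fst]
    have e2 : ∫⁻ p, tl M p.2 ∂(σ k) = ∫⁻ y, tl M y ∂ν := by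
      rw [← (hσ k).2.2, lintegral_map hm2 measurable_snd]
    have e3 : ∫⁻ p, tl M (T p.1) ∂(σ k) = ∫⁻ y, tl M y ∂ν := by
      rw [← hμT, lintegral_map hm2 hT, ← (hσ k).2.1]
      exact (lintegral_map (hm2.comp hT) measurable_fst).symm
    rw [e1, e2, e3]
    gcongr
    exact lint_FF hμ hν (hσ k) hγ
  rw [ENNReal.tendsto_nhds_zero]
  intro ε hε
  have hε4 : 0 < ε / 4 := ENNReal.div_pos hε.ne' (by simp)
  obtain ⟨M, hM⟩ := ((ENNReal.tendsto_nhds_zero.1 (tl_tendsto hν)) _ hε4).exists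
  obtain ⟨n, hn⟩ := ((ENNReal.tendsto_nhds_zero.1 (hhlim M)) _ hε4).exists
  have hgap : Tendsto (fun k => (n : ℝ≥0∞) * ENNReal.ofReal ((tcost (σ k) - tcost γ) / 2)) atTop
      (𝓝 0) := by
    have h1 : Tendsto (fun k => (tcost (σ k) - tcost γ) / 2) atTop (𝓝 0) := by
      simpa using (hlim.sub_const (tcost γ)).div_const 2
    have h2 := ENNReal.tendsto_ofReal h1
    have h3 := ENNReal.Tendsto.const_mul (a := (n : ℝ≥0∞)) h2 (Or.inr (by simp))
    simpa using h3
  filter_upwards [ENNReal.tendsto_nhds_zero.1 hgap _ hε4] with k hk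
  refine (hbound M n k).trans ?_
  calc _ ≤ (ε / 4 + ε / 4) + (ε / 4 + ε / 4) := by gcongr
    _ = ε := by
      rw [← two_mul, ← two_mul, ← mul_assoc]
      norm_num
      exact ENNReal.mul_div_cancel (by simp) (by simp)

/-- Gluing of two measures with the same first marginal. -/
theorem glue {X Y Z : Type*} [MeasurableSpace X] [MeasurableSpace Y] [MeasurableSpace Z]
    [StandardBorelSpace Z] [Nonempty Z]
    (α : Measure (X × Y)) (β : Measure (X × Z)) [IsProbabilityMeasure α] [IsProbabilityMeasure β]
    (h : α.map Prod.fst = β.map Prod.fst) :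
    ∃ π : Measure ((X × Y) × Z), IsProbabilityMeasure π ∧ π.map Prod.fst = α ∧
      π.map (fun z => (z.1.1, z.2)) = β := by
  have hdis : β.fst ⊗ₘ β.condKernel = β := β.disintegrate β.condKernel
  refine ⟨α ⊗ₘ (Kernel.prodMkRight Y β.condKernel), inferInstance, ?_, ?_⟩
  · exact Measure.fst_compProd _ _
  · ext s hs
    rw [Measure.map_apply (by fun_prop) hs, Measure.compProd_apply (hs.preimage (by fun_prop))]
    conv_rhs => rw [← hdis, Measure.compProd_apply hs, Measure.fst, ← h,
      lintegral_map (Kernel.measurable_kernel_prodMk_left hs) measurable_fst]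
    rfl

/-- Gluing along a chain `x — x' — y' — y`. -/
theorem glue4 {μ' ν' μ ν : Measure (Ed d)} {θ α β : Measure (Ed d × Ed d)}
    (hθ : IsCoupling θ μ' ν') (hα : IsCoupling α μ' μ) (hβ : IsCoupling β ν' ν) :
    ∃ (π : Measure ((Ed d × Ed d × Ed d) × Ed d)), IsProbabilityMeasure π ∧
      π.map (fun z => (z.1.2.1, z.1.1)) = θ ∧ π.map (fun z => (z.1.2.1, z.1.2.2)) = α ∧
      π.map (fun z => (z.1.1, z.2)) = β := by
  have := hθ.1
  have := hα.1
  have := hβ.1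
  obtain ⟨π₁, hp₁, h1, h2⟩ := glue θ α (by rw [hθ.2.1, hα.2.1])
  -- reorder so that `y'` is the first coordinate
  set π₂ : Measure (Ed d × Ed d × Ed d) := π₁.map (fun z => (z.1.2, z.1.1, z.2)) with hπ₂
  have hp₂ : IsProbabilityMeasure π₂ := Measure.isProbabilityMeasure_map (by fun_prop)
  obtain ⟨π, hp, h3, h4⟩ := glue π₂ β (by
    rw [hβ.2.1, ← hθ.2.2, ← h1, hπ₂, Measure.map_map measurable_fst (by fun_prop),
      Measure.map_map measurable_snd measurable_fst]
    rfl)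
  refine ⟨π, hp, ?_, ?_, h4⟩
  · have : (fun z : (Ed d × Ed d × Ed d) × Ed d => (z.1.2.1, z.1.1)) =
      (fun w : Ed d × Ed d × Ed d => (w.2.1, w.1)) ∘ Prod.fst := rfl
    rw [this, ← Measure.map_map (by fun_prop) measurable_fst, h3, hπ₂,
      Measure.map_map (by fun_prop) (by fun_prop), ← h1]
    rfl
  · have : (fun z : (Ed d × Ed d × Ed d) × Ed d => (z.1.2.1, z.1.2.2)) =
      (fun w : Ed d × Ed d × Ed d => (w.2.1, w.2.2)) ∘ Prod.fst := rfl
    rw [this, ← Measure.map_map (by fun_prop) measurable_fst, h3, hπ₂,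
      Measure.map_map (by fun_prop) (by fun_prop), ← h2]
    rfl

end Conv

section Final
variable {d : ℕ}

theorem integral_add3 {Ω : Type*} [MeasurableSpace Ω] {m : Measure Ω} {f g h : Ω → ℝ}
    (hf : Integrable f m) (hg : Integrable g m) (hh : Integrable h m) :
    ∫ z, (f z + g z + h z) ∂m = ∫ z, f z ∂m + ∫ z, g z ∂m + ∫ z, h z ∂m := by
  rw [← integral_add hf hg]
  exact integral_add (hf.add hg) hh

theorem sqrt_int_add_le {Ω : Type*} [MeasurableSpace Ω] {m : Measure Ω} {a b : Ω → Ed d}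
    (ha : Measurable a) (hb : Measurable b) (ha2 : Integrable (fun z => ‖a z‖ ^ 2) m)
    (hb2 : Integrable (fun z => ‖b z‖ ^ 2) m) :
    √(∫ z, ‖a z + b z‖ ^ 2 ∂m) ≤ √(∫ z, ‖a z‖ ^ 2 ∂m) + √(∫ z, ‖b z‖ ^ 2 ∂m) := by
  have hA : MemLp (fun z => ‖a z‖) (ENNReal.ofReal 2) m := by
    rw [show ENNReal.ofReal 2 = 2 by simp]
    exact (memLp_two_iff_integrable_sq (by fun_prop)).2 ha2
  have hB : MemLp (fun z => ‖b z‖) (ENNReal.ofReal 2) m := by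
    rw [show ENNReal.ofReal 2 = 2 by simp]
    exact (memLp_two_iff_integrable_sq (by fun_prop)).2 hb2
  have hCS := integral_mul_norm_le_Lp_mul_Lq Real.HolderConjugate.two_two hA hB
  simp only [norm_norm, Real.rpow_two, ← Real.sqrt_eq_rpow] at hCS
  have hi := int_inner ha hb ha2 hb2
  have hab : Integrable (fun z => ‖a z‖ * ‖b z‖) m := by
    refine (ha2.add hb2).mono' (by fun_prop) (ae_of_all _ fun z => ?_)
    rw [Real.norm_of_nonneg (by positivity)]
    simp only [Pi.add_apply]
    nlinarith [sq_nonneg (‖a z‖ - ‖b z‖), sq_nonneg (‖a z‖), sq_nonneg (‖b z‖)]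
  have h1 : ∫ z, ‖a z + b z‖ ^ 2 ∂m ≤
      ∫ z, (‖a z‖ ^ 2 + ‖b z‖ ^ 2 + 2 * (‖a z‖ * ‖b z‖)) ∂m := by
    refine integral_mono_of_nonneg (ae_of_all _ fun z => by positivity)
      ((ha2.add hb2).add (hab.const_mul 2)) (ae_of_all _ fun z => ?_)
    have := norm_add_le (a z) (b z)
    have h0 := norm_nonneg (a z + b z)
    simp only
    nlinarith
  rw [integral_add3 ha2 hb2 (hab.const_mul 2), integral_const_mul] at h1
  have hA0 : 0 ≤ ∫ z, ‖a z‖ ^ 2 ∂m := integral_nonneg fun _ => by positivity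
  have hB0 : 0 ≤ ∫ z, ‖b z‖ ^ 2 ∂m := integral_nonneg fun _ => by positivity
  apply Real.sqrt_le_iff.2 ⟨by positivity, ?_⟩
  have := Real.sq_sqrt hA0
  have := Real.sq_sqrt hB0
  nlinarith

theorem tcost_map {Ω : Type*} [MeasurableSpace Ω] {m : Measure Ω} {a b : Ω → Ed d}
    (ha : Measurable a) (hb : Measurable b) :
    tcost (m.map (fun z => (a z, b z))) = ∫ z, ‖a z - b z‖ ^ 2 ∂m := by
  unfold tcost
  rw [integral_map (ha.prodMk hb).aemeasurable (by fun_prop)]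

theorem int_of_map {Ω : Type*} [MeasurableSpace Ω] {m : Measure Ω} {a : Ω → Ed d}
    (ha : Measurable a) {μ : Measure (Ed d)} (h : m.map a = μ) (hμ : MemP2 μ) :
    Integrable (fun z => ‖a z‖ ^ 2) m := by
  have := hμ.2
  rw [← h] at this
  exact this.comp_measurable ha

theorem map_pair {Ω : Type*} [MeasurableSpace Ω] {m : Measure Ω} {a b : Ω → Ed d}
    (ha : Measurable a) (hb : Measurable b) {θ : Measure (Ed d × Ed d)} {μ ν : Measure (Ed d)}
    (hθ : IsCoupling θ μ ν) (h : m.map (fun z => (a z, b z)) = θ) :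
    m.map a = μ ∧ m.map b = ν := by
  constructor
  · rw [← hθ.2.1, ← h, Measure.map_map measurable_fst (ha.prodMk hb)]; rfl
  · rw [← hθ.2.2, ← h, Measure.map_map measurable_snd (ha.prodMk hb)]; rfl

theorem triangle {μ' ν' μ ν : Measure (Ed d)} {θ α β : Measure (Ed d × Ed d)}
    (hμ' : MemP2 μ') (hν' : MemP2 ν') (hμ : MemP2 μ) (hν : MemP2 ν)
    (hθ : IsCoupling θ μ' ν') (hα : IsCoupling α μ' μ) (hβ : IsCoupling β ν' ν) :
    ∃ (π : Measure ((Ed d × Ed d × Ed d) × Ed d)), IsProbabilityMeasure π ∧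
      π.map (fun z => (z.1.2.1, z.1.1)) = θ ∧ π.map (fun z => (z.1.2.1, z.1.2.2)) = α ∧
      π.map (fun z => (z.1.1, z.2)) = β ∧
      IsCoupling (π.map (fun z => (z.1.2.2, z.2))) μ ν ∧
      √(tcost (π.map (fun z => (z.1.2.2, z.2)))) ≤ √(tcost θ) + √(tcost α) + √(tcost β) := by
  obtain ⟨π, hp, h1, h2, h3⟩ := glue4 hθ hα hβ
  have m1 : Measurable (fun z : (Ed d × Ed d × Ed d) × Ed d => z.1.1) := by fun_prop
  have m2 : Measurable (fun z : (Ed d × Ed d × Ed d) × Ed d => z.1.2.1) := by fun_prop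
  have m3 : Measurable (fun z : (Ed d × Ed d × Ed d) × Ed d => z.1.2.2) := by fun_prop
  have m4 : Measurable (fun z : (Ed d × Ed d × Ed d) × Ed d => z.2) := by fun_prop
  obtain ⟨p2, p1⟩ := map_pair m2 m1 hθ h1
  obtain ⟨-, p3⟩ := map_pair m2 m3 hα h2
  obtain ⟨-, p4⟩ := map_pair m1 m4 hβ h3
  have i1 := int_of_map m1 p1 hν'
  have i2 := int_of_map m2 p2 hμ'
  have i3 := int_of_map m3 p3 hμ
  have i4 := int_of_map m4 p4 hν
  refine ⟨π, hp, h1, h2, h3, ⟨Measure.isProbabilityMeasure_map (by fun_prop), ?_, ?_⟩, ?_⟩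
  · rw [Measure.map_map measurable_fst (by fun_prop)]; exact p3
  · rw [Measure.map_map measurable_snd (by fun_prop)]; exact p4
  · rw [tcost_map m3 m4, ← h1, ← h2, ← h3, tcost_map m2 m1, tcost_map m2 m3, tcost_map m1 m4]
    have j1 := int_sub_sq m2 m1 i2 i1
    have j2 := int_sub_sq m3 m2 i3 i2
    have j3 := int_sub_sq m1 m4 i1 i4
    have j4 := int_sub_sq m3 m1 i3 i1
    have k1 := sqrt_int_add_le (m3.sub m1) (m1.sub m4) j4 j3
    have k2 := sqrt_int_add_le (m2.sub m1) (m3.sub m2) j1 j2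
    simp only [Pi.sub_apply, sub_add_sub_cancel] at k1 k2
    have e : ∀ z : (Ed d × Ed d × Ed d) × Ed d,
        z.1.2.1 - z.1.1 + (z.1.2.2 - z.1.2.1) = z.1.2.2 - z.1.1 := fun z => by abel
    simp only [e] at k2
    simp only [norm_sub_rev (Prod.fst (Prod.snd (Prod.fst _))) (Prod.snd (Prod.snd (Prod.fst _)))]
    linarith

theorem swap_coupling {μ ν : Measure (Ed d)} {θ : Measure (Ed d × Ed d)} (h : IsCoupling θ μ ν) :
    IsCoupling (θ.map Prod.swap) ν μ ∧ tcost (θ.map Prod.swap) = tcost θ := by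
  have := h.1
  refine ⟨⟨Measure.isProbabilityMeasure_map (by fun_prop), ?_, ?_⟩, ?_⟩
  · rw [Measure.map_map measurable_fst measurable_swap]; exact h.2.2
  · rw [Measure.map_map measurable_snd measurable_swap]; exact h.2.1
  · unfold tcost
    rw [integral_map measurable_swap.aemeasurable (by fun_prop)]
    simp only [Prod.fst_swap, Prod.snd_swap, norm_sub_rev]

theorem near_tendsto {μk : ℕ → Measure (Ed d)} {μ : Measure (Ed d)} (hμk : ∀ k, MemP2 (μk k))
    (hμ : MemP2 μ) (hc : Tendsto (fun k => W2 (μk k) μ) atTop (𝓝 0)) :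
    ∃ α : ℕ → Measure (Ed d × Ed d), (∀ k, IsCoupling (α k) (μk k) μ) ∧
      Tendsto (fun k => tcost (α k)) atTop (𝓝 0) := by
  have h := fun k : ℕ => exists_near (hμk k) hμ (ε := 1 / ((k : ℝ) + 1)) (by positivity)
  choose α hα hc' using h
  refine ⟨α, hα, ?_⟩
  refine squeeze_zero (fun k => tcost_nonneg _) (fun k => (hc' k).le) ?_
  simpa using (hc.pow 2).add tendsto_one_div_add_atTop_nhds_zero_nat

/-- Cost of the final coupling. -/
theorem final_bound {t : ℝ} (ht : t ∈ Set.Icc (0 : ℝ) 1) (x' y' x y w : Ed d) :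
    ‖((1 - t) • x' + t • y') - ((1 - t) • x + t • w)‖ ^ 2 ≤
      3 * (‖x' - x‖ ^ 2 + ‖y' - y‖ ^ 2 + ‖y - w‖ ^ 2) := by
  obtain ⟨h0, h1⟩ := ht
  have e : ((1 - t) • x' + t • y') - ((1 - t) • x + t • w) =
      (1 - t) • (x' - x) + t • (y' - y) + t • (y - w) := by module
  have h : ‖((1 - t) • x' + t • y') - ((1 - t) • x + t • w)‖ ≤ ‖x' - x‖ + ‖y' - y‖ + ‖y - w‖ := by
    rw [e]
    refine norm_add₃_le.trans ?_
    rw [norm_smul, norm_smul, norm_smul, Real.norm_of_nonneg h0,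
      Real.norm_of_nonneg (by linarith : 0 ≤ 1 - t)]
    nlinarith [norm_nonneg (x' - x), norm_nonneg (y' - y), norm_nonneg (y - w)]
  calc _ ≤ (‖x' - x‖ + ‖y' - y‖ + ‖y - w‖) ^ 2 := by gcongr
    _ ≤ _ := by
      nlinarith [sq_nonneg (‖x' - x‖ - ‖y' - y‖), sq_nonneg (‖x' - x‖ - ‖y - w‖),
        sq_nonneg (‖y' - y‖ - ‖y - w‖)]

end Final

/-- Stability of geodesic interpolants: if `μ, ν ∈ 𝒫_{2,ac}(ℝ^d)`,
`W₂(μ_k,μ) → 0`, `W₂(ν_k,ν) → 0`, `γ_k` are optimal couplings of `(μ_k,ν_k)` and `γ` is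
the (unique) optimal coupling of `(μ,ν)`, then for every `t ∈ [0,1]` the interpolants
satisfy `W₂(η_t^k, η_t) → 0`. -/
theorem geodesic_interp_stability {d : ℕ}
    (μ ν : Measure (Ed d)) (hμ : MemP2 μ) (hν : MemP2 ν)
    (hμac : μ ≪ (volume : Measure (Ed d))) (hνac : ν ≪ (volume : Measure (Ed d)))
    (μk νk : ℕ → Measure (Ed d)) (hμk : ∀ k, MemP2 (μk k)) (hνk : ∀ k, MemP2 (νk k))
    (hμconv : Tendsto (fun k => W2 (μk k) μ) atTop (𝓝 0))
    (hνconv : Tendsto (fun k => W2 (νk k) ν) atTop (𝓝 0))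
    (γk : ℕ → Measure (Ed d × Ed d)) (hγk : ∀ k, IsOptimalCoupling (γk k) (μk k) (νk k))
    (γ : Measure (Ed d × Ed d)) (hγ : IsOptimalCoupling γ μ ν) :
    ∀ t ∈ Set.Icc (0 : ℝ) 1,
      Tendsto (fun k => W2 (couplingInterp (γk k) t) (couplingInterp γ t)) atTop (𝓝 0) := by
  intro t ht
  obtain ⟨T, hT, hTγ, hgood⟩ := exists_map hμ hν hμac hγ
  obtain ⟨α, hα, hα0⟩ := near_tendsto hμk hμ hμconv
  obtain ⟨β, hβ, hβ0⟩ := near_tendsto hνk hν hνconv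
  have hμT : μ.map T = ν := by
    rw [← hγ.1.2.1, ← hγ.1.2.2, Measure.map_map hT measurable_fst]
    exact Measure.map_congr (hTγ.mono fun p hp => hp.symm)
  have hπ := fun k => triangle (hμk k) (hνk k) hμ hν (hγk k).1 (hα k) (hβ k)
  choose π hp h1 h2 h3 hσ htri using hπ
  set σ : ℕ → Measure (Ed d × Ed d) := fun k => (π k).map (fun z => (z.1.2.2, z.2)) with hσdef
  have hrev : ∀ k, √(tcost (γk k)) ≤ √(tcost γ) + √(tcost (α k)) + √(tcost (β k)) := by
    intro k
    obtain ⟨ca, ea⟩ := swap_coupling (hα k)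
    obtain ⟨cb, eb⟩ := swap_coupling (hβ k)
    obtain ⟨π', -, -, -, -, hc, hle⟩ := triangle hμ hν (hμk k) (hνk k) hγ.1 ca cb
    rw [ea, eb] at hle
    refine le_trans (Real.sqrt_le_sqrt ?_) hle
    exact (le_of_eq (hγk k).2).trans (W2_sq_le hc)
  have hs : Tendsto (fun k => √(tcost (σ k))) atTop (𝓝 (√(tcost γ))) := by
    have hu : Tendsto (fun k => √(tcost γ) + √(tcost (α k)) + √(tcost (β k)) + √(tcost (α k)) +
        √(tcost (β k))) atTop (𝓝 (√(tcost γ))) := by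
      have ha := hα0.sqrt
      have hb := hβ0.sqrt
      rw [Real.sqrt_zero] at ha hb
      simpa using (((ha.const_add (√(tcost γ))).add hb).add ha).add hb
    refine tendsto_of_tendsto_of_tendsto_of_le_of_le tendsto_const_nhds hu (fun k => ?_)
      (fun k => ?_)
    · exact Real.sqrt_le_sqrt ((le_of_eq hγ.2).trans (W2_sq_le (hσ k)))
    · have := htri k
      have := hrev k
      simp only [hσdef]
      linarith
  have hlim : Tendsto (fun k => tcost (σ k)) atTop (𝓝 (tcost γ)) := by
    have := hs.pow 2
    simpa only [Real.sq_sqrt (tcost_nonneg _)] using this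
  have hconv := map_conv hμ hν hγ hT hTγ hgood σ hσ hlim
  have hc0 : Tendsto (fun k => ∫ p, ‖p.2 - T p.1‖ ^ 2 ∂(σ k)) atTop (𝓝 0) := by
    have h := (ENNReal.tendsto_toReal ENNReal.zero_ne_top).comp hconv
    rw [ENNReal.toReal_zero] at h
    refine h.congr fun k => ?_
    rw [integral_eq_lintegral_of_nonneg_ae (ae_of_all _ fun _ => by positivity) (by fun_prop)]
    rfl
  have hW : ∀ k, W2 (couplingInterp (γk k) t) (couplingInterp γ t) ^ 2 ≤
      3 * (tcost (α k) + tcost (β k) + ∫ p, ‖p.2 - T p.1‖ ^ 2 ∂(σ k)) := by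
    intro k
    have := hp k
    have m1 : Measurable (fun z : (Ed d × Ed d × Ed d) × Ed d => z.1.1) := by fun_prop
    have m2 : Measurable (fun z : (Ed d × Ed d × Ed d) × Ed d => z.1.2.1) := by fun_prop
    have m3 : Measurable (fun z : (Ed d × Ed d × Ed d) × Ed d => z.1.2.2) := by fun_prop
    have m4 : Measurable (fun z : (Ed d × Ed d × Ed d) × Ed d => z.2) := by fun_prop
    have m5 : Measurable (fun z : (Ed d × Ed d × Ed d) × Ed d => T z.1.2.2) := hT.comp m3
    obtain ⟨p2, p1⟩ := map_pair m2 m1 (hγk k).1 (h1 k)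
    obtain ⟨-, p3⟩ := map_pair m2 m3 (hα k) (h2 k)
    obtain ⟨-, p4⟩ := map_pair m1 m4 (hβ k) (h3 k)
    have p5 : (π k).map (fun z => T z.1.2.2) = ν := by
      rw [← hμT, ← p3, Measure.map_map hT m3]; rfl
    have i1 := int_of_map m1 p1 (hνk k)
    have i2 := int_of_map m2 p2 (hμk k)
    have i3 := int_of_map m3 p3 hμ
    have i4 := int_of_map m4 p4 hν
    have i5 := int_of_map m5 p5 hν
    have j1 := int_sub_sq m2 m3 i2 i3
    have j2 := int_sub_sq m1 m4 i1 i4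
    have j3 := int_sub_sq m4 m5 i4 i5
    have n1 : Measurable (fun z : (Ed d × Ed d × Ed d) × Ed d =>
      (1 - t) • z.1.2.1 + t • z.1.1) := by fun_prop
    have n2 : Measurable (fun z : (Ed d × Ed d × Ed d) × Ed d =>
      (1 - t) • z.1.2.2 + t • T z.1.2.2) := by fun_prop
    have hcoup : IsCoupling ((π k).map (fun z => ((1 - t) • z.1.2.1 + t • z.1.1,
        (1 - t) • z.1.2.2 + t • T z.1.2.2))) (couplingInterp (γk k) t) (couplingInterp γ t) := by
      refine ⟨Measure.isProbabilityMeasure_map (n1.prodMk n2).aemeasurable, ?_, ?_⟩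
      · rw [Measure.map_map measurable_fst (n1.prodMk n2), couplingInterp, ← h1 k,
          Measure.map_map (by fun_prop) (by fun_prop)]
        rfl
      · have e : couplingInterp γ t = μ.map (fun x => (1 - t) • x + t • T x) := by
          rw [couplingInterp, ← hγ.1.2.1, Measure.map_map (by fun_prop) measurable_fst]
          refine Measure.map_congr (hTγ.mono fun p hp => ?_)
          simp only [Function.comp, hp]
        rw [e, ← p3, Measure.map_map measurable_snd (n1.prodMk n2),
          Measure.map_map (by fun_prop) m3]
        rfl
    refine (W2_sq_le hcoup).trans ?_
    rw [tcost_map n1 n2, ← h2 k, ← h3 k, tcost_map m2 m3, tcost_map m1 m4,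
      integral_map (by fun_prop) (by fun_prop)]
    simp only
    rw [← integral_add3 j1 j2 j3, ← integral_const_mul]
    refine integral_mono_of_nonneg (ae_of_all _ fun z => by positivity)
      (((j1.add j2).add j3).const_mul 3) (ae_of_all _ fun z => ?_)
    exact final_bound ht _ _ _ _ _
  have hlim2 : Tendsto (fun k => W2 (couplingInterp (γk k) t) (couplingInterp γ t) ^ 2) atTop
      (𝓝 0) := by
    refine squeeze_zero (fun k => sq_nonneg _) hW ?_
    simpa using ((hα0.add hβ0).add hc0).const_mul 3
  have h := hlim2.sqrt
  simpa only [Real.sqrt_zero, Real.sqrt_sq (W2_nonneg _ _)] using h
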